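/- arXiv:2508.04602 — 2 statements merged into one kernel-verified Lean document; each statement's English description precedes it below -/
import Mathlib

section
/- Let T be a triangle with vertices V_1, V_2, V_3, and let A = {A_1,...,A_m} be a finite set of points in the interior of T such that {V_1,V_2,V_3} ∪ A is in general position (no three points collinear) and no three lines through six distinct points of the configuration are concurrent. Let c_1, c_2, c_3 be nonnegative integers with c_1+c_2+c_3 = m. Then there exists a point Q in the interior of T such that exactly c_1 points of A lie in the interior of triangle V_1V_2Q, exactly c_2 points lie in the interior of triangle V_2V_3Q (equivalently the triangle QV_2V_3 as labelled), and exactly c_3 points lie in the interior of triangle V_1QV_3, with no point of A on the segments QV_1, QV_2, QV_3. -/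
open Set

/-- A set of points is in general position if no three distinct points of it are
collinear. -/
def GenPos (S : Set (ℝ × ℝ)) : Prop :=
  ∀ p ∈ S, ∀ q ∈ S, ∀ r ∈ S, p ≠ q → p ≠ r → q ≠ r →
    ¬ Collinear ℝ ({p, q, r} : Set (ℝ × ℝ))

/-- The line through two (distinct) points, as a set of points. -/
def lineThrough (a b : ℝ × ℝ) : Set (ℝ × ℝ) :=
  {x | Collinear ℝ ({a, b, x} : Set (ℝ × ℝ))}

/-- `S` is in general⁺ position: general position, and no three lines through six
distinct points of `S` are concurrent at a point outside `S`. -/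
def GenPlusPos (S : Set (ℝ × ℝ)) : Prop :=
  GenPos S ∧
    ∀ a ∈ S, ∀ b ∈ S, ∀ c ∈ S, ∀ d ∈ S, ∀ e ∈ S, ∀ f ∈ S,
      ([a, b, c, d, e, f] : List (ℝ × ℝ)).Pairwise (· ≠ ·) →
      ∀ x ∉ S, ¬ (x ∈ lineThrough a b ∧ x ∈ lineThrough c d ∧ x ∈ lineThrough e f)

/-- Twice the signed area of the triangle `p q r`. -/
def orient (p q r : ℝ × ℝ) : ℝ :=
  (q.1 - p.1) * (r.2 - p.2) - (q.2 - p.2) * (r.1 - p.1)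

lemma collinear_iff_orient (p q r : ℝ × ℝ) :
    Collinear ℝ ({p, q, r} : Set (ℝ × ℝ)) ↔ orient p q r = 0 := by
  constructor
  · intro h
    obtain ⟨v, hv⟩ := (collinear_iff_of_mem (p₀ := p) (by simp)).1 h
    obtain ⟨s, rfl⟩ := hv q (by simp)
    obtain ⟨t, rfl⟩ := hv r (by simp)
    simp [orient]
    ring
  · intro h
    by_cases hpq : q = p
    · subst hpq
      simpa using collinear_pair ℝ q r
    have hpos : (q.1 - p.1) ^ 2 + (q.2 - p.2) ^ 2 ≠ 0 := by
      intro h0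
      apply hpq
      ext <;> nlinarith [sq_nonneg (q.1 - p.1), sq_nonneg (q.2 - p.2)]
    refine (collinear_iff_of_mem (p₀ := p) (by simp)).2 ⟨q - p, ?_⟩
    rintro x (rfl | rfl | rfl)
    · exact ⟨0, by simp⟩
    · exact ⟨1, by simp⟩
    · refine ⟨((x.1 - p.1) * (q.1 - p.1) + (x.2 - p.2) * (q.2 - p.2)) /
        ((q.1 - p.1) ^ 2 + (q.2 - p.2) ^ 2), ?_⟩
      unfold orient at h
      ext
      · simp
        field_simp
        linear_combination (p.2 - q.2) * h
      · simp
        field_simp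
        linear_combination (q.1 - p.1) * h

/-- `x` has barycentric coordinates `t` with respect to the points `V`. -/
def IsBary (V : Fin 3 → ℝ × ℝ) (t : Fin 3 → ℝ) (x : ℝ × ℝ) : Prop :=
  ∑ i, t i = 1 ∧ x = ∑ i, t i • V i

lemma Fin.sum_three_of_ne {M : Type*} [AddCommMonoid M] (f : Fin 3 → M) {i j k : Fin 3}
    (hij : i ≠ j) (hik : i ≠ k) (hjk : j ≠ k) : ∑ l, f l = f i + f j + f k := by
  have : (Finset.univ : Finset (Fin 3)) = {i, j, k} := by
    revert i j k; decide
  rw [this, Finset.sum_insert (by simp [*]), Finset.sum_pair hjk, add_assoc]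

lemma IsBary.orient_eq {V : Fin 3 → ℝ × ℝ} {s t : Fin 3 → ℝ} {x y : ℝ × ℝ}
    (hx : IsBary V s x) (hy : IsBary V t y) {i j k : Fin 3}
    (hij : i ≠ j) (hik : i ≠ k) (hjk : j ≠ k) :
    orient (V k) x y = (s i * t j - s j * t i) * orient (V k) (V i) (V j) := by
  obtain ⟨h1, rfl⟩ := hx
  obtain ⟨h2, rfl⟩ := hy
  rw [Fin.sum_three_of_ne _ hij hik hjk] at h1 h2 ⊢
  rw [Fin.sum_three_of_ne _ hij hik hjk]
  have h1' : s k = 1 - s i - s j := by linarith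
  have h2' : t k = 1 - t i - t j := by linarith
  simp [orient, h1', h2']
  ring

lemma isBary_vertex (V : Fin 3 → ℝ × ℝ) (k : Fin 3) : IsBary V (Pi.single k 1) (V k) := by
  constructor
  · simp
  · simp [Pi.single_apply]

lemma mem_interior_convexHull_iff {p q r : ℝ × ℝ} (h : orient p q r ≠ 0) (x : ℝ × ℝ) :
    x ∈ interior (convexHull ℝ ({p, q, r} : Set (ℝ × ℝ))) ↔
      ∃ t : Fin 3 → ℝ, (∀ i, 0 < t i) ∧ IsBary ![p, q, r] t x := by
  rw [Ne, ← collinear_iff_orient, ← affineIndependent_iff_not_collinear_set] at h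
  have htop : affineSpan ℝ (Set.range ![p, q, r]) = ⊤ := by
    rw [h.affineSpan_eq_top_iff_card_eq_finrank_add_one]
    simp
  let b : AffineBasis (Fin 3) ℝ (ℝ × ℝ) := ⟨![p, q, r], h, htop⟩
  have hr : ({p, q, r} : Set (ℝ × ℝ)) = Set.range b := by
    change _ = Set.range ![p, q, r]
    ext y
    simp [eq_comm (a := y)]
    tauto
  rw [hr, b.interior_convexHull]
  constructor
  · intro hx
    refine ⟨fun i => b.coord i x, hx, b.sum_coord_apply_eq_one x, ?_⟩
    exact (b.linear_combination_coord_eq_self x).symm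
  · rintro ⟨t, ht, h1, hx⟩ i
    have hx' : x = Finset.univ.affineCombination ℝ b t := by
      rw [Finset.affineCombination_eq_linear_combination _ _ _ h1]
      exact hx
    rw [hx', b.coord_apply_combination_of_mem (Finset.mem_univ i) h1]
    exact ht i

lemma orient_ne_zero {V : Fin 3 → ℝ × ℝ} (hV : orient (V 0) (V 1) (V 2) ≠ 0) {i j k : Fin 3}
    (hij : i ≠ j) (hik : i ≠ k) (hjk : j ≠ k) : orient (V i) (V j) (V k) ≠ 0 := by
  unfold orient at *
  contrapose! hV
  fin_cases i <;> fin_cases j <;> fin_cases k <;> simp at * <;> linarith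

lemma IsBary.unique {V : Fin 3 → ℝ × ℝ} (hV : orient (V 0) (V 1) (V 2) ≠ 0)
    {s t : Fin 3 → ℝ} {x : ℝ × ℝ} (hs : IsBary V s x) (ht : IsBary V t x) : s = t := by
  funext i
  obtain ⟨j, k, hij, hik, hjk⟩ : ∃ j k, i ≠ j ∧ i ≠ k ∧ j ≠ k := by
    revert i; decide
  have h1 := hs.orient_eq (isBary_vertex V j) hij hik hjk
  have h2 := ht.orient_eq (isBary_vertex V j) hij hik hjk
  have := orient_ne_zero hV hik.symm hjk.symm hij
  rw [h1] at h2
  simpa [hij, this] using mul_right_cancel₀ this h2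

lemma mem_interior_subtriangle_iff {V : Fin 3 → ℝ × ℝ}
    (hV : orient (V 0) (V 1) (V 2) ≠ 0) {q t : Fin 3 → ℝ} {Q x : ℝ × ℝ}
    (hQ : IsBary V q Q) (hx : IsBary V t x) (ht : ∀ i, 0 < t i) (hq : ∀ i, 0 < q i)
    {i j k : Fin 3} (hij : i ≠ j) (hik : i ≠ k) (hjk : j ≠ k) :
    x ∈ interior (convexHull ℝ ({V i, V j, Q} : Set (ℝ × ℝ))) ↔
      t k * q i < t i * q k ∧ t k * q j < t j * q k := by
  have hne : orient (V i) (V j) Q ≠ 0 := by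
    rw [(isBary_vertex V j).orient_eq hQ hjk hij.symm hik.symm]
    simpa [hjk, hjk.symm, (hq k).ne'] using orient_ne_zero hV hij hik hjk
  rw [mem_interior_convexHull_iff hne]
  constructor
  · rintro ⟨s, hs, hs1, rfl⟩
    rw [Fin.sum_univ_three] at hs1
    have : IsBary V (s 0 • Pi.single i 1 + s 1 • Pi.single j 1 + s 2 • q)
        (∑ l, s l • ![V i, V j, Q] l) := by
      constructor
      · simp [Finset.sum_add_distrib, ← Finset.mul_sum, hQ.1, hs1]
      · simp [add_smul, mul_smul, Finset.sum_add_distrib,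
          ← Finset.smul_sum, ← hQ.2, Pi.single_apply, Fin.sum_univ_three]
    obtain rfl := hx.unique hV this
    have h0 := hs 0
    have h1 := hs 1
    have h2 := hs 2
    have h3 := hq k
    simp [hij, hij.symm, hik.symm, hjk.symm]
    constructor <;> nlinarith [mul_pos h0 h3, mul_pos h1 h3]
  · rintro ⟨h1, h2⟩
    have hk := hq k
    refine ⟨![t i - t k * q i / q k, t j - t k * q j / q k, t k / q k], ?_, ?_⟩
    · intro l
      fin_cases l
      · simpa [div_lt_iff₀ hk] using h1
      · simpa [div_lt_iff₀ hk] using h2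
      · simpa using div_pos (ht k) hk
    obtain ⟨hQ1, rfl⟩ := hQ
    obtain ⟨hx1, rfl⟩ := hx
    rw [Fin.sum_three_of_ne _ hij hik hjk] at hQ1 hx1
    constructor
    · simp [Fin.sum_univ_three]
      field_simp
      linear_combination q k * hx1 - t k * hQ1
    · rw [Fin.sum_three_of_ne (fun l => t l • V l) hij hik hjk,
        Fin.sum_three_of_ne (fun l => q l • V l) hij hik hjk, Fin.sum_univ_three]
      ext <;> simp <;> field_simp <;> ring

lemma notMem_segment_of_lt {V : Fin 3 → ℝ × ℝ}
    (hV : orient (V 0) (V 1) (V 2) ≠ 0) {q t : Fin 3 → ℝ} {Q x : ℝ × ℝ}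
    (hQ : IsBary V q Q) (hx : IsBary V t x) (hq : ∀ i, 0 < q i)
    {k : Fin 3} (hk : ∀ l ≠ k, t k * q l < t l * q k) (n : Fin 3) :
    x ∉ segment ℝ Q (V n) := by
  rintro ⟨a, b, ha, hb, hab, rfl⟩
  have : IsBary V (a • q + b • Pi.single n 1) (a • Q + b • V n) := by
    constructor
    · simp [Finset.sum_add_distrib, ← Finset.mul_sum, hQ.1, hab]
    · simp [add_smul, mul_smul, Finset.sum_add_distrib, ← Finset.smul_sum, ← hQ.2]
  obtain rfl := hx.unique hV this
  obtain ⟨l, hlk, hln⟩ : ∃ l, l ≠ k ∧ l ≠ n := by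
    clear * -; revert k n; decide
  have h := hk l hlk
  simp [hln] at h
  have : 0 ≤ b * Pi.single (M := fun _ => ℝ) n 1 k * q l :=
    mul_nonneg (mul_nonneg hb (by by_cases h : k = n <;> simp [h])) (hq l).le
  nlinarith

lemma exists_potential (d : Fin 3 → Fin 3 → ℝ) (h2 : ∀ i j, i ≠ j → 0 < d i j + d j i)
    (h3 : ∀ i j k, i ≠ j → i ≠ k → j ≠ k → 0 < d i j + d j k + d k i) :
    ∃ w : Fin 3 → ℝ, ∀ i j, i ≠ j → w j - w i < d i j := by
  have a1 := h2 0 1 (by decide)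
  have a2 := h2 0 2 (by decide)
  have a3 := h2 1 2 (by decide)
  have a4 := h3 0 1 2 (by decide) (by decide) (by decide)
  have a5 := h3 0 2 1 (by decide) (by decide) (by decide)
  obtain ⟨e, he, b1, b2, b3, b4, b5⟩ : ∃ e > 0, 2 * e ≤ d 0 1 + d 1 0 ∧ 2 * e ≤ d 0 2 + d 2 0 ∧
      2 * e ≤ d 1 2 + d 2 1 ∧ 3 * e ≤ d 0 1 + d 1 2 + d 2 0 ∧
      3 * e ≤ d 0 2 + d 2 1 + d 1 0 := by
    have : ∃ m > 0, m ≤ d 0 1 + d 1 0 ∧ m ≤ d 0 2 + d 2 0 ∧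
        m ≤ d 1 2 + d 2 1 ∧ m ≤ d 0 1 + d 1 2 + d 2 0 ∧
        m ≤ d 0 2 + d 2 1 + d 1 0 :=
      ⟨min (d 0 1 + d 1 0) (min (d 0 2 + d 2 0) (min (d 1 2 + d 2 1)
        (min (d 0 1 + d 1 2 + d 2 0) (d 0 2 + d 2 1 + d 1 0)))), by simp [*], by simp⟩
    obtain ⟨m, hm, b1, b2, b3, b4, b5⟩ := this
    exact ⟨m / 3, by positivity, by linarith, by linarith, by linarith, by linarith, by linarith⟩
  refine ⟨![0, min (d 0 1 - e) (d 0 2 + d 2 1 - 2 * e),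
    min (d 0 2 - e) (d 0 1 + d 1 2 - 2 * e)], ?_⟩
  intro i j hij
  rcases min_cases (d 0 1 - e) (d 0 2 + d 2 1 - 2 * e) with ⟨m1, _⟩ | ⟨m1, _⟩ <;>
  rcases min_cases (d 0 2 - e) (d 0 1 + d 1 2 - 2 * e) with ⟨m2, _⟩ | ⟨m2, _⟩ <;>
  rw [m1, m2] <;> fin_cases i <;> fin_cases j <;> simp at hij ⊢ <;> linarith

lemma exists_card_fiber_eq {ι κ : Type*} [Fintype ι] [Fintype κ] [DecidableEq κ]
    (c : κ → ℕ) (hc : ∑ k, c k = Fintype.card ι) :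
    ∃ σ : ι → κ, ∀ k, (Finset.univ.filter (σ · = k)).card = c k := by
  let e : ι ≃ Σ k, Fin (c k) := Fintype.equivOfCardEq (by simp [hc])
  refine ⟨fun i => (e i).1, fun k => ?_⟩
  rw [← Fintype.card_subtype]
  have f : {i // (e i).1 = k} ≃ Fin (c k) :=
    (e.subtypeEquiv fun _ => Iff.rfl).trans (Equiv.sigmaSubtype k)
  simpa using Fintype.card_congr f

/-- An assignment with prescribed fibre sizes and least total cost. -/
lemma exists_min_assignment {ι κ : Type*} [Fintype ι] [DecidableEq ι] [Fintype κ]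
    [DecidableEq κ] (u : ι → κ → ℝ) (c : κ → ℕ) (hc : ∑ k, c k = Fintype.card ι) :
    ∃ σ : ι → κ, (∀ k, (Finset.univ.filter (σ · = k)).card = c k) ∧
      ∀ π : Equiv.Perm ι, ∑ a, u a (σ a) ≤ ∑ a, u a (σ (π a)) := by
  obtain ⟨σ, hσ⟩ := exists_card_fiber_eq c hc
  obtain ⟨ρ, hρ⟩ := Finite.exists_min fun ρ : Equiv.Perm ι => ∑ a, u a (σ (ρ a))
  refine ⟨σ ∘ ρ, fun k => ?_, fun π => hρ (π.trans ρ)⟩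
  rw [← hσ k]
  exact Finset.card_equiv ρ (by simp)

lemma exists_strict_assignment {ι : Type*} [Fintype ι] [DecidableEq ι] (u : ι → Fin 3 → ℝ)
    (c : Fin 3 → ℕ) (hc : ∑ k, c k = Fintype.card ι)
    (h2 : ∀ a b, a ≠ b → ∀ i j, i ≠ j → u a i + u b j ≠ u a j + u b i)
    (h3 : ∀ a b c, a ≠ b → a ≠ c → b ≠ c → ∀ i j k, i ≠ j → i ≠ k → j ≠ k →
      u a i + u b j + u c k ≠ u a j + u b k + u c i) :
    ∃ (σ : ι → Fin 3) (w : Fin 3 → ℝ), (∀ k, (Finset.univ.filter (σ · = k)).card = c k) ∧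
      ∀ a k, k ≠ σ a → u a (σ a) - w (σ a) < u a k - w k := by
  obtain ⟨σ, hσ, hmin⟩ := exists_min_assignment u c hc
  have hne : ∀ {a b}, σ a ≠ σ b → a ≠ b := fun h h' => h (h' ▸ rfl)
  have cyc2 : ∀ a b, σ a ≠ σ b →
      0 < (u a (σ b) - u a (σ a)) + (u b (σ a) - u b (σ b)) := by
    intro a b hab
    have h := hmin (Equiv.swap a b)
    rw [← sub_nonneg, ← Finset.sum_sub_distrib,
      ← Finset.sum_subset (Finset.subset_univ {a, b}), Finset.sum_pair (hne hab)] at h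
    · simp only [Equiv.swap_apply_left, Equiv.swap_apply_right] at h
      refine lt_of_le_of_ne h fun h0 => h2 a b (hne hab) (σ a) (σ b) hab (by linarith)
    · intro x _ hx
      simp only [Finset.mem_insert, Finset.mem_singleton, not_or] at hx
      rw [Equiv.swap_apply_of_ne_of_ne hx.1 hx.2, sub_self]
  have cyc3 : ∀ a b c, σ a ≠ σ b → σ a ≠ σ c → σ b ≠ σ c →
      0 < (u a (σ b) - u a (σ a)) + (u b (σ c) - u b (σ b)) + (u c (σ a) - u c (σ c)) := by
    intro a b c hab hac hbc
    have h := hmin (Equiv.swap a b * Equiv.swap b c)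
    have e1 : (Equiv.swap a b * Equiv.swap b c) a = b := by
      simp [Equiv.swap_apply_of_ne_of_ne (hne hab) (hne hac)]
    have e2 : (Equiv.swap a b * Equiv.swap b c) b = c := by
      simp [Equiv.swap_apply_of_ne_of_ne (hne hac).symm (hne hbc).symm]
    have e3 : (Equiv.swap a b * Equiv.swap b c) c = a := by simp
    rw [← sub_nonneg, ← Finset.sum_sub_distrib,
      ← Finset.sum_subset (Finset.subset_univ {a, b, c}),
      Finset.sum_insert (by simp [hne hab, hne hac]), Finset.sum_pair (hne hbc), e1, e2, e3] at h
    · refine lt_of_le_of_ne (by linarith) fun h0 =>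
        h3 a b c (hne hab) (hne hac) (hne hbc) (σ a) (σ b) (σ c) hab hac hbc (by linarith)
    · intro x _ hx
      simp only [Finset.mem_insert, Finset.mem_singleton, not_or] at hx
      rw [Equiv.Perm.mul_apply, Equiv.swap_apply_of_ne_of_ne hx.2.1 hx.2.2,
        Equiv.swap_apply_of_ne_of_ne hx.1 hx.2.1, sub_self]
  obtain ⟨B, hB⟩ : ∃ B, ∀ a i j, |u a j - u a i| ≤ B := by
    obtain ⟨B, hB⟩ := (Set.finite_range
      fun p : ι × Fin 3 × Fin 3 => |u p.1 p.2.2 - u p.1 p.2.1|).bddAbove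
    exact ⟨B, fun a i j => hB ⟨(a, i, j), rfl⟩⟩
  have hd : ∀ i j, ∃ d, (∀ a, σ a = i → d ≤ u a j - u a i) ∧ -|B| ≤ d ∧
      ((∃ a, σ a = i ∧ d = u a j - u a i) ∨ d = 2 * |B| + 1) := by
    intro i j
    rcases (Finset.univ.filter (σ · = i)).eq_empty_or_nonempty with he | he
    · refine ⟨2 * |B| + 1, fun a ha => ?_, by linarith [abs_nonneg B], Or.inr rfl⟩
      exact absurd he (Finset.ne_empty_of_mem (a := a) (by simp [ha]))
    · obtain ⟨a, ha, hmin⟩ := Finset.exists_min_image _ (fun a => u a j - u a i) he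
      refine ⟨u a j - u a i, fun b hb => hmin b (by simp [hb]), ?_,
        Or.inl ⟨a, by simpa using ha, rfl⟩⟩
      linarith [neg_abs_le (u a j - u a i), hB a i j, le_abs_self B]
  choose d hd1 hdB hd2 using hd
  obtain ⟨w, hw⟩ := exists_potential d
    (by
      intro i j hij
      have b1 := hdB i j
      have b2 := hdB j i
      rcases hd2 i j with ⟨a, rfl, ha⟩ | h
      · rcases hd2 j (σ a) with ⟨b, rfl, hb⟩ | h
        · rw [ha, hb]
          exact cyc2 a b hij
        · linarith [abs_nonneg B]
      · linarith [abs_nonneg B])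
    (by
      intro i j k hij hik hjk
      have b1 := hdB i j
      have b2 := hdB j k
      have b3 := hdB k i
      rcases hd2 i j with ⟨a, rfl, ha⟩ | h
      · rcases hd2 j k with ⟨b, rfl, hb⟩ | h
        · rcases hd2 k (σ a) with ⟨c, rfl, hc⟩ | h
          · rw [ha, hb, hc]
            exact cyc3 a b c hij hik hjk
          · linarith
        · linarith
      · linarith)
  refine ⟨σ, w, hσ, fun a k hk => ?_⟩
  linarith [hw (σ a) k hk.symm, hd1 (σ a) k a rfl]

lemma GenPos.notMem_lineThrough {S : Set (ℝ × ℝ)} (h : GenPos S) {p q r : ℝ × ℝ}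
    (hp : p ∈ S) (hq : q ∈ S) (hr : r ∈ S) (hpq : p ≠ q) (hpr : p ≠ r) (hqr : q ≠ r) :
    r ∉ lineThrough p q :=
  h p hp q hq r hr hpq hpr hqr

/-- In general position, two interior points have distinct coordinate ratios. -/
lemma GenPos.bary_ne {S : Set (ℝ × ℝ)} (h : GenPos S) {V : Fin 3 → ℝ × ℝ}
    (hVS : ∀ i, V i ∈ S) {a b : ℝ × ℝ} (ha : a ∈ S) (hb : b ∈ S) (hab : a ≠ b)
    (haV : ∀ i, V i ≠ a) (hbV : ∀ i, V i ≠ b) {s t : Fin 3 → ℝ} (hs : IsBary V s a)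
    (ht : IsBary V t b) {i j : Fin 3} (hij : i ≠ j) : s i * t j ≠ s j * t i := by
  obtain ⟨k, hik, hjk⟩ : ∃ k, i ≠ k ∧ j ≠ k := by
    clear * -; revert i j; decide
  intro he
  refine h (V k) (hVS k) a ha b hb (haV k) (hbV k) hab ?_
  rw [collinear_iff_orient, hs.orient_eq ht hij hik hjk, he, sub_self, zero_mul]

/-- In general⁺ position, three interior points do not satisfy the Ceva relation. -/
lemma GenPlusPos.ceva_ne {S : Set (ℝ × ℝ)} (h : GenPlusPos S) {V : Fin 3 → ℝ × ℝ}
    (hVS : ∀ i, V i ∈ S) (hV : Function.Injective V) {a b c : ℝ × ℝ} (ha : a ∈ S) (hb : b ∈ S)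
    (hc : c ∈ S) (hab : a ≠ b) (hac : a ≠ c) (hbc : b ≠ c)
    (haV : ∀ i, V i ≠ a) (hbV : ∀ i, V i ≠ b) (hcV : ∀ i, V i ≠ c) {r s t : Fin 3 → ℝ}
    (hr : IsBary V r a) (hs : IsBary V s b) (ht : IsBary V t c)
    (hr0 : ∀ i, 0 < r i) (hs0 : ∀ i, 0 < s i)
    {i j k : Fin 3} (hij : i ≠ j) (hik : i ≠ k) (hjk : j ≠ k) :
    r i * s j * t k ≠ r j * s k * t i := by
  intro he
  have hpos : 0 < r i * s j + r j * s j + r j * s k := by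
    have := hr0 i; have := hr0 j; have := hs0 j; have := hs0 k
    positivity
  set n := r i * s j + r j * s j + r j * s k with hn
  let p : Fin 3 → ℝ := n⁻¹ • (Pi.single i (r i * s j) + Pi.single j (r j * s j) +
    Pi.single k (r j * s k))
  have hpi : p i = n⁻¹ * (r i * s j) := by simp [p, hij, hik]
  have hpj : p j = n⁻¹ * (r j * s j) := by simp [p, hij.symm, hjk]
  have hpk : p k = n⁻¹ * (r j * s k) := by simp [p, hik.symm, hjk.symm]
  have hp : IsBary V p (∑ l, p l • V l) := by
    refine ⟨?_, rfl⟩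
    rw [Fin.sum_three_of_ne p hij hik hjk, hpi, hpj, hpk, ← mul_add, ← mul_add, ← hn,
      inv_mul_cancel₀ hpos.ne']
  set P := ∑ l, p l • V l
  have ha' : P ∈ lineThrough (V k) a := by
    refine (collinear_iff_orient _ _ _).2 ?_
    rw [hr.orient_eq hp hij hik hjk, hpi, hpj]
    ring
  have hb' : P ∈ lineThrough (V i) b := by
    refine (collinear_iff_orient _ _ _).2 ?_
    rw [hs.orient_eq hp hjk hij.symm hik.symm, hpj, hpk]
    ring
  have hc' : P ∈ lineThrough (V j) c := by
    refine (collinear_iff_orient _ _ _).2 ?_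
    rw [ht.orient_eq hp hik.symm hjk.symm hij, hpi, hpk]
    linear_combination n⁻¹ * he * orient (V j) (V k) (V i)
  have off : ∀ {l x}, x ∈ S → (∀ i, V i ≠ x) → P ∈ lineThrough (V l) x → P ∈ S →
      P = V l ∨ P = x := by
    intro l x hx hxV hP hPS
    by_contra! hne
    exact h.1.notMem_lineThrough (hVS l) hx hPS (hxV l) hne.1.symm hne.2.symm hP
  have hPS : P ∉ S := by
    intro hPS
    have hVik := hV.ne hik
    have hVij := hV.ne hij
    rcases off ha haV ha' hPS with h1 | h1 <;> rcases off hb hbV hb' hPS with h2 | h2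
    · exact hVik (h2.symm.trans h1)
    · exact hbV k (h1.symm.trans h2)
    · exact haV i (h2.symm.trans h1)
    · exact hab (h1.symm.trans h2)
  refine h.2 _ (hVS k) a ha _ (hVS i) b hb _ (hVS j) c hc ?_ P hPS ⟨ha', hb', hc'⟩
  simp [haV, hbV, hcV, (haV _).symm, (hbV _).symm, hV.eq_iff, hij, hik.symm, hjk.symm,
    hab, hac, hbc]

/-- splitting a triangle by an interior point `Q` into three subtriangles
containing prescribed numbers `c₁, c₂, c₃` of the `m` given interior points. -/
theorem stmt3 (V₁ V₂ V₃ : ℝ × ℝ) (hV : ¬ Collinear ℝ ({V₁, V₂, V₃} : Set (ℝ × ℝ)))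
    (A : Finset (ℝ × ℝ)) (m : ℕ) (hm : A.card = m)
    (hA : ↑A ⊆ interior (convexHull ℝ ({V₁, V₂, V₃} : Set (ℝ × ℝ))))
    (hgen : GenPlusPos ({V₁, V₂, V₃} ∪ ↑A))
    (c₁ c₂ c₃ : ℕ) (hc : c₁ + c₂ + c₃ = m) :
    ∃ Q ∈ interior (convexHull ℝ ({V₁, V₂, V₃} : Set (ℝ × ℝ))),
      ((↑A : Set (ℝ × ℝ)) ∩ interior (convexHull ℝ ({V₁, V₂, Q} : Set (ℝ × ℝ)))).ncard = c₁ ∧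
      ((↑A : Set (ℝ × ℝ)) ∩ interior (convexHull ℝ ({V₂, V₃, Q} : Set (ℝ × ℝ)))).ncard = c₂ ∧
      ((↑A : Set (ℝ × ℝ)) ∩ interior (convexHull ℝ ({V₁, Q, V₃} : Set (ℝ × ℝ)))).ncard = c₃ ∧
      ∀ W ∈ ({V₁, V₂, V₃} : Set (ℝ × ℝ)), ∀ a ∈ A, a ∉ segment ℝ Q W := by
  classical
  let V : Fin 3 → ℝ × ℝ := ![V₁, V₂, V₃]
  have hinj : Function.Injective V := (affineIndependent_iff_not_collinear_set.2 hV).injective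
  rw [collinear_iff_orient] at hV
  change orient (V 0) (V 1) (V 2) ≠ 0 at hV
  have hbary : ∀ a : A, ∃ t : Fin 3 → ℝ, (∀ i, 0 < t i) ∧ IsBary V t a := fun a =>
    (mem_interior_convexHull_iff hV _).1 (hA a.2)
  choose t ht hta using hbary
  set S : Set (ℝ × ℝ) := {V₁, V₂, V₃} ∪ ↑A
  have hVS : ∀ i, V i ∈ S := by
    intro i
    left
    fin_cases i <;> simp [V]
  have hAS : ∀ a : A, (a : ℝ × ℝ) ∈ S := fun a => Or.inr a.2
  have hVA : ∀ (a : A) i, V i ≠ a := by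
    intro a i hi
    obtain ⟨j, hj⟩ : ∃ j, j ≠ i := exists_ne i
    have := (isBary_vertex V i).unique hV (hi ▸ hta a)
    have h0 := ht a j
    simp [← this, hj] at h0
  have hlog : ∀ a i, t a i ≠ 0 := fun a i => (ht a i).ne'
  obtain ⟨σ, w, hσ, hw⟩ := exists_strict_assignment (fun a i => Real.log (t a i)) ![c₂, c₃, c₁]
    (by simp [Fin.sum_univ_three]; omega)
    (by
      intro a b hab i j hij he
      rw [← Real.log_mul (hlog _ _) (hlog _ _), ← Real.log_mul (hlog _ _) (hlog _ _)] at he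
      refine hgen.1.bary_ne hVS (hAS a) (hAS b) (Subtype.coe_injective.ne hab) (hVA a) (hVA b)
        (hta a) (hta b) hij (Real.log_injOn_pos ?_ ?_ he)
      · exact mul_pos (ht _ _) (ht _ _)
      · exact mul_pos (ht _ _) (ht _ _))
    (by
      intro a b c hab hac hbc i j k hij hik hjk he
      have hprod : ∀ i j k, 0 < t a i * t b j * t c k := fun i j k =>
        mul_pos (mul_pos (ht _ _) (ht _ _)) (ht _ _)
      rw [← Real.log_mul (hlog _ _) (hlog _ _), ← Real.log_mul (hlog _ _) (hlog _ _),
        ← Real.log_mul (mul_ne_zero (hlog _ _) (hlog _ _)) (hlog _ _),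
        ← Real.log_mul (mul_ne_zero (hlog _ _) (hlog _ _)) (hlog _ _)] at he
      exact hgen.ceva_ne hVS hinj (hAS a) (hAS b) (hAS c) (Subtype.coe_injective.ne hab)
        (Subtype.coe_injective.ne hac) (Subtype.coe_injective.ne hbc) (hVA a) (hVA b) (hVA c)
        (hta a) (hta b) (hta c) (ht a) (ht b) hij hik hjk
        (Real.log_injOn_pos (hprod _ _ _) (hprod _ _ _) he))
  have hpos : 0 < ∑ l, Real.exp (w l) :=
    Finset.sum_pos (fun l _ => Real.exp_pos _) Finset.univ_nonempty
  let q : Fin 3 → ℝ := fun i => Real.exp (w i) / ∑ l, Real.exp (w l)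
  have hq : ∀ i, 0 < q i := fun i => div_pos (Real.exp_pos _) hpos
  have hlt : ∀ a, ∀ l ≠ σ a, t a (σ a) * q l < t a l * q (σ a) := by
    intro a l hl
    have h := Real.exp_lt_exp.2 (hw a l hl)
    rw [Real.exp_sub, Real.exp_sub, Real.exp_log (ht _ _), Real.exp_log (ht _ _),
      div_lt_div_iff₀ (Real.exp_pos _) (Real.exp_pos _)] at h
    simp only [q, ← mul_div_assoc]
    exact div_lt_div_of_pos_right h hpos
  have hQ : IsBary V q (∑ l, q l • V l) := by
    refine ⟨?_, rfl⟩
    rw [← Finset.sum_div, div_self hpos.ne']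
  set Q := ∑ l, q l • V l
  have hcount : ∀ i j k, i ≠ j → i ≠ k → j ≠ k →
      ((↑A : Set (ℝ × ℝ)) ∩ interior (convexHull ℝ ({V i, V j, Q} : Set (ℝ × ℝ)))).ncard =
        (![c₂, c₃, c₁] : Fin 3 → ℕ) k := by
    intro i j k hij hik hjk
    rw [← hσ k, ← Set.ncard_coe_finset, ← Set.ncard_image_of_injective _ Subtype.coe_injective]
    congr 1
    ext x
    simp only [Set.mem_inter_iff, Finset.mem_coe, Set.mem_image, Finset.coe_filter,
      Finset.mem_univ, true_and, Set.mem_ofPred_eq, Subtype.exists, exists_and_right,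
      exists_eq_right]
    constructor
    · rintro ⟨hx, hxi⟩
      refine ⟨hx, ?_⟩
      rw [mem_interior_subtriangle_iff hV hQ (hta ⟨x, hx⟩) (ht _) hq hij hik hjk] at hxi
      by_contra hne
      have h := hlt ⟨x, hx⟩ k (Ne.symm hne)
      have : σ ⟨x, hx⟩ = i ∨ σ ⟨x, hx⟩ = j := by
        generalize σ ⟨x, hx⟩ = l at hne
        clear * - hij hik hjk hne
        revert i j k l; decide
      rcases this with h' | h' <;> rw [h'] at h
      · exact lt_asymm h hxi.1
      · exact lt_asymm h hxi.2
    · rintro ⟨hx, rfl⟩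
      refine ⟨hx, ?_⟩
      rw [mem_interior_subtriangle_iff hV hQ (hta ⟨x, hx⟩) (ht _) hq hij hik hjk]
      exact ⟨hlt _ _ hik, hlt _ _ hjk⟩
  refine ⟨Q, (mem_interior_convexHull_iff hV _).2 ⟨q, hq, hQ⟩, ?_, ?_, ?_, ?_⟩
  · exact hcount 0 1 2 (by decide) (by decide) (by decide)
  · exact hcount 1 2 0 (by decide) (by decide) (by decide)
  · rw [Set.pair_comm Q V₃]
    exact hcount 0 2 1 (by decide) (by decide) (by decide)
  · intro W hW a ha
    obtain ⟨n, rfl⟩ : ∃ n, V n = W := by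
      simpa [V, Fin.exists_fin_succ, eq_comm] using hW
    exact notMem_segment_of_lt hV hQ (hta ⟨a, ha⟩) hq (hlt ⟨a, ha⟩) n
end

section
/- Let T = XYZ be a triangle, F a point in its interior, and G a point in the interior of triangle FYZ such that G and Y are strictly on the same side of line FX. Let K be a point in the interior of triangle FZX. Then the ray from G through K exits the triangle XYZ through the (open) side XZ. -/
noncomputable section
open Set

/-- 2D cross product (orientation test) of `b - a` and `c - a`. -/
def cross2 (a b c : ℝ × ℝ) : ℝ :=
  (b.1 - a.1) * (c.2 - a.2) - (b.2 - a.2) * (c.1 - a.1)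

/-- `v` lists the vertices of a (strictly) convex polygon in counterclockwise order:
every vertex other than the endpoints of an edge lies strictly to the left of that
edge.  In particular no interior angle is flat. -/
def IsConvexPolygonCCW {n : ℕ} [NeZero n] (v : Fin n → ℝ × ℝ) : Prop :=
  3 ≤ n ∧ ∀ i j : Fin n, j ≠ i → j ≠ i + 1 → 0 < cross2 (v i) (v (i + 1)) (v j)

/-- Three non-collinear points of the plane, as an affine basis. -/
def planeBasis (A B C : ℝ × ℝ) (h : ¬ Collinear ℝ ({A, B, C} : Set (ℝ × ℝ))) :
    AffineBasis (Fin 3) ℝ (ℝ × ℝ) where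
  toFun := ![A, B, C]
  ind' := affineIndependent_iff_not_collinear_set.2 h
  tot' := (affineIndependent_iff_not_collinear_set.2 h).affineSpan_eq_top_iff_card_eq_finrank_add_one.2
    (by simp)

lemma range_planeBasis {A B C : ℝ × ℝ} (h : ¬ Collinear ℝ ({A, B, C} : Set (ℝ × ℝ))) :
    range (planeBasis A B C h) = {A, B, C} := by
  change range ![A, B, C] = _
  simp only [Matrix.range_cons, Matrix.range_empty, union_empty, singleton_union]

lemma planeBasis_coord_combination {A B C : ℝ × ℝ} (h : ¬ Collinear ℝ ({A, B, C} : Set (ℝ × ℝ)))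
    {a b c : ℝ} (hs : a + b + c = 1) (i : Fin 3) :
    (planeBasis A B C h).coord i (a • A + b • B + c • C) = ![a, b, c] i := by
  have hw : ∑ j, ![a, b, c] j = 1 := by simp [Fin.sum_univ_three, hs]
  have key := (planeBasis A B C h).coord_apply_combination_of_mem (Finset.mem_univ i) hw
  rw [Finset.univ.affineCombination_eq_linear_combination _ _ hw, Fin.sum_univ_three] at key
  exact key

lemma combination_mem_interior_triangle_iff {A B C : ℝ × ℝ}
    (h : ¬ Collinear ℝ ({A, B, C} : Set (ℝ × ℝ))) {a b c : ℝ} (hs : a + b + c = 1) :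
    a • A + b • B + c • C ∈ interior (convexHull ℝ ({A, B, C} : Set (ℝ × ℝ))) ↔
      0 < a ∧ 0 < b ∧ 0 < c := by
  rw [← range_planeBasis h, AffineBasis.interior_convexHull]
  simp [planeBasis_coord_combination h hs, Fin.forall_fin_succ]

lemma combination_mem_triangle_iff {A B C : ℝ × ℝ}
    (h : ¬ Collinear ℝ ({A, B, C} : Set (ℝ × ℝ))) {a b c : ℝ} (hs : a + b + c = 1) :
    a • A + b • B + c • C ∈ convexHull ℝ ({A, B, C} : Set (ℝ × ℝ)) ↔
      0 ≤ a ∧ 0 ≤ b ∧ 0 ≤ c := by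
  rw [← range_planeBasis h, AffineBasis.convexHull_eq_nonneg_coord]
  simp [planeBasis_coord_combination h hs, Fin.forall_fin_succ]

lemma combination_mem_frontier_triangle_iff {A B C : ℝ × ℝ}
    (h : ¬ Collinear ℝ ({A, B, C} : Set (ℝ × ℝ))) {a b c : ℝ} (hs : a + b + c = 1) :
    a • A + b • B + c • C ∈ frontier (convexHull ℝ ({A, B, C} : Set (ℝ × ℝ))) ↔
      (0 ≤ a ∧ 0 ≤ b ∧ 0 ≤ c) ∧ ¬ (0 < a ∧ 0 < b ∧ 0 < c) := by
  rw [(Set.toFinite _).isClosed_convexHull ℝ |>.frontier_eq, mem_sdiff,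
    combination_mem_triangle_iff h hs, combination_mem_interior_triangle_iff h hs]

lemma not_collinear_of_mem_interior_triangle {A B C P : ℝ × ℝ}
    (hP : P ∈ interior (convexHull ℝ ({A, B, C} : Set (ℝ × ℝ)))) :
    ¬ Collinear ℝ ({A, B, C} : Set (ℝ × ℝ)) := by
  have htop := interior_convexHull_nonempty_iff_affineSpan_eq_top.1 ⟨P, hP⟩
  intro hc
  have hle := collinear_iff_finrank_le_one.1 hc
  rw [← direction_affineSpan, htop, AffineSubspace.direction_top, finrank_top] at hle
  simp at hle

lemma exists_pos_weights_of_mem_interior_triangle {A B C P : ℝ × ℝ}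
    (hP : P ∈ interior (convexHull ℝ ({A, B, C} : Set (ℝ × ℝ)))) :
    ∃ a b c : ℝ, 0 < a ∧ 0 < b ∧ 0 < c ∧ a + b + c = 1 ∧ P = a • A + b • B + c • C := by
  have h := not_collinear_of_mem_interior_triangle hP
  have hs := (planeBasis A B C h).sum_coord_apply_eq_one P
  have hc := (planeBasis A B C h).linear_combination_coord_eq_self P
  rw [Fin.sum_univ_three] at hs hc
  have heq : P = _ • A + _ • B + _ • C := hc.symm
  rw [heq, combination_mem_interior_triangle_iff h hs] at hP
  exact ⟨_, _, _, hP.1, hP.2.1, hP.2.2, hs, heq⟩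

/-- if `F` is interior to triangle `XYZ`, `G` is interior to triangle
`FYZ` with `G` and `Y` strictly on the same side of line `FX`, and `K` is interior to
triangle `FZX`, then the ray from `G` through `K` exits the triangle `XYZ` through the
open side `XZ`: it meets the boundary of `XYZ`, and every boundary point it meets lies
on the open segment `XZ`. -/
theorem stmt17 (X Y Z F G K : ℝ × ℝ)
    (hXYZ : ¬ Collinear ℝ ({X, Y, Z} : Set (ℝ × ℝ)))
    (hF : F ∈ interior (convexHull ℝ ({X, Y, Z} : Set (ℝ × ℝ))))
    (hG : G ∈ interior (convexHull ℝ ({F, Y, Z} : Set (ℝ × ℝ))))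
    (hside : 0 < cross2 F X G * cross2 F X Y)
    (hK : K ∈ interior (convexHull ℝ ({F, Z, X} : Set (ℝ × ℝ)))) :
    (∃ t : ℝ, 0 < t ∧
      G + t • (K - G) ∈ frontier (convexHull ℝ ({X, Y, Z} : Set (ℝ × ℝ)))) ∧
    (∀ t : ℝ, 0 < t →
      G + t • (K - G) ∈ frontier (convexHull ℝ ({X, Y, Z} : Set (ℝ × ℝ))) →
      G + t • (K - G) ∈ openSegment ℝ X Z) := by
  obtain ⟨a, b, c, ha, hb, hc, hs, rfl⟩ := exists_pos_weights_of_mem_interior_triangle hF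
  obtain ⟨g, p, q, hg, hp, hq, hgs, rfl⟩ := exists_pos_weights_of_mem_interior_triangle hG
  obtain ⟨k, s, r, hk, hsp, hr, hks, rfl⟩ := exists_pos_weights_of_mem_interior_triangle hK
  have hpq : q * b < p * c := by
    obtain rfl : a = 1 - b - c := by linarith
    obtain rfl : g = 1 - p - q := by linarith
    have hprod : 0 < c * cross2 X Y Z ^ 2 * (p * c - q * b) := by
      convert hside using 1
      simp only [cross2, Prod.fst_add, Prod.snd_add, Prod.smul_fst, Prod.smul_snd, smul_eq_mul]
      ring
    have := pos_of_mul_pos_right hprod (by positivity)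
    linarith
  set x : ℝ → ℝ := fun t => (1 - t) * (g * a) + t * (k * a + r) with hx
  set y : ℝ → ℝ := fun t => (1 - t) * (g * b + p) + t * (k * b) with hy
  set z : ℝ → ℝ := fun t => (1 - t) * (g * c + q) + t * (k * c + s) with hz
  have hsum (t : ℝ) : x t + y t + z t = 1 := by
    simp only [hx, hy, hz]
    linear_combination ((1 - t) * g + t * k) * hs + (1 - t) * hgs + t * hks
  have hray (t : ℝ) : g • (a • X + b • Y + c • Z) + p • Y + q • Z +
      t • (k • (a • X + b • Y + c • Z) + s • Z + r • X -
        (g • (a • X + b • Y + c • Z) + p • Y + q • Z)) = x t • X + y t • Y + z t • Z := by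
    simp only [hx, hy, hz]
    module
  simp only [hray]
  have hxy {t : ℝ} (ht : 1 ≤ t) : a * y t < b * x t := by
    have : b * x t - a * y t = (t - 1) * (a * p) + t * (b * r) := by simp only [hx, hy]; ring
    have : 0 ≤ (t - 1) * (a * p) := mul_nonneg (by linarith) (by positivity)
    have : 0 < t * (b * r) := by positivity
    linarith
  have hzy {t : ℝ} (ht : 1 ≤ t) : c * y t < b * z t := by
    have : b * z t - c * y t = (t - 1) * (p * c - q * b) + t * (b * s) := by
      simp only [hz, hy]; ring
    have : 0 ≤ (t - 1) * (p * c - q * b) := mul_nonneg (by linarith) (by linarith)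
    have : 0 < t * (b * s) := by positivity
    linarith
  constructor
  · have hslope : k * b < g * b + p := by
      have : g * b + p - k * b = a * p + b * r + (p * c - q * b) + b * s := by
        linear_combination b * hgs - b * hks - p * hs
      nlinarith [mul_pos ha hp, mul_pos hb hr, mul_pos hb hsp]
    set t := (g * b + p) / (g * b + p - k * b) with ht
    have hden : 0 < g * b + p - k * b := by linarith
    have ht1 : 1 ≤ t := (one_le_div hden).2 (by nlinarith [mul_pos hk hb])
    have hy0 : y t = 0 := by
      have : t * (g * b + p - k * b) = g * b + p := div_mul_cancel₀ _ hden.ne'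
      simp only [hy]
      linear_combination -this
    have hx0 : 0 < x t := pos_of_mul_pos_right (by simpa [hy0] using hxy ht1) hb.le
    have hz0 : 0 < z t := pos_of_mul_pos_right (by simpa [hy0] using hzy ht1) hb.le
    exact ⟨t, by linarith, (combination_mem_frontier_triangle_iff hXYZ (hsum t)).2
      ⟨⟨hx0.le, hy0.ge, hz0.le⟩, fun h => h.2.1.ne' hy0⟩⟩
  · intro t ht hfr
    obtain ⟨⟨hx0, hy0, hz0⟩, hn⟩ := (combination_mem_frontier_triangle_iff hXYZ (hsum t)).1 hfr
    have ht1 : 1 ≤ t := by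
      by_contra! hlt
      have h1 : 0 < 1 - t := by linarith
      exact hn ⟨by positivity, by positivity, by positivity⟩
    have hxpos : 0 < x t :=
      pos_of_mul_pos_right ((mul_nonneg ha.le hy0).trans_lt (hxy ht1)) hb.le
    have hzpos : 0 < z t :=
      pos_of_mul_pos_right ((mul_nonneg hc.le hy0).trans_lt (hzy ht1)) hb.le
    have hyz : y t = 0 := by
      by_contra hne
      exact hn ⟨hxpos, hy0.lt_of_ne' hne, hzpos⟩
    exact ⟨x t, z t, hxpos, hzpos, by simpa [hyz] using hsum t, by simp [hyz]⟩
end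
end
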